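/- Let ε ∈ [0,1) and T, S ∈ B(H). Then T ⊥ε_ω S if and only if for every θ ∈ [0, 2π) the numerical radius derivative satisfies D^θ_ω(T, S) ≥ −ε ω(T) ω(S), i.e., inf over θ ∈ [0, 2π) of D^θ_ω(T, S) is at least −ε ω(T) ω(S). -/

import Mathlib

open Filter Topology
open scoped InnerProductSpace

variable {H : Type*} [NormedAddCommGroup H] [InnerProductSpace ℂ H] [CompleteSpace H]

/-- The numerical radius of a bounded operator `T`:
`ω(T) = sup {|⟨Tx, x⟩| : ‖x‖ = 1}`. -/
noncomputable def nrad (T : H →L[ℂ] H) : ℝ :=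
  sSup {r : ℝ | ∃ x : H, ‖x‖ = 1 ∧ r = ‖⟪x, T x⟫_ℂ‖}

/-- Approximate numerical-radius (Birkhoff) orthogonality:
`T ⊥ε_ω S` iff `ω(T + λS)² ≥ ω(T)² − 2ε ω(T) ω(λS)` for all `λ ∈ ℂ`. -/
def NradOrth (ε : ℝ) (T S : H →L[ℂ] H) : Prop :=
  ∀ μ : ℂ, nrad T ^ 2 - 2 * ε * nrad T * nrad (μ • S) ≤ nrad (T + μ • S) ^ 2

omit [CompleteSpace H] in
lemma nrad_bddAbove (T : H →L[ℂ] H) :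
    BddAbove {r : ℝ | ∃ x : H, ‖x‖ = 1 ∧ r = ‖⟪x, T x⟫_ℂ‖} := by
  refine ⟨‖T‖, ?_⟩
  rintro r ⟨x, hx, rfl⟩
  calc ‖⟪x, T x⟫_ℂ‖ ≤ ‖x‖ * ‖T x‖ := norm_inner_le_norm _ _
    _ ≤ ‖T‖ := by simpa [hx] using T.le_opNorm x

omit [CompleteSpace H] in
lemma norm_inner_le_nrad (T : H →L[ℂ] H) {x : H} (hx : ‖x‖ = 1) : ‖⟪x, T x⟫_ℂ‖ ≤ nrad T :=
  le_csSup (nrad_bddAbove T) ⟨x, hx, rfl⟩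

omit [CompleteSpace H] in
lemma nrad_nonneg (T : H →L[ℂ] H) : 0 ≤ nrad T := by
  refine Real.sSup_nonneg ?_
  rintro r ⟨x, -, rfl⟩
  exact norm_nonneg _

omit [CompleteSpace H] in
lemma nrad_add_le (T S : H →L[ℂ] H) : nrad (T + S) ≤ nrad T + nrad S := by
  refine Real.sSup_le ?_ (add_nonneg (nrad_nonneg T) (nrad_nonneg S))
  rintro r ⟨x, hx, rfl⟩
  rw [add_apply, inner_add_right]
  exact (norm_add_le _ _).trans
    (add_le_add (norm_inner_le_nrad T hx) (norm_inner_le_nrad S hx))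

omit [CompleteSpace H] in
lemma nrad_smul (c : ℂ) (T : H →L[ℂ] H) : nrad (c • T) = ‖c‖ * nrad T := by
  unfold nrad
  rw [← smul_eq_mul, ← Real.sSup_smul_of_nonneg (norm_nonneg c)]
  congr 1
  ext r
  simp only [Set.mem_smul_set, Set.mem_ofPred_eq, smul_apply,
    inner_smul_right, norm_mul, smul_eq_mul]
  constructor
  · rintro ⟨x, hx, rfl⟩
    exact ⟨_, ⟨x, hx, rfl⟩, rfl⟩
  · rintro ⟨_, ⟨x, hx, rfl⟩, rfl⟩
    exact ⟨x, hx, rfl⟩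

omit [CompleteSpace H] in
/-- The square of the numerical radius is convex along the segment from `T` to `T + S`. -/
lemma nrad_add_smul_sq_le (T S : H →L[ℂ] H) {t : ℝ} (ht0 : 0 ≤ t) (ht1 : t ≤ 1) :
    nrad (T + (t : ℂ) • S) ^ 2 ≤ (1 - t) * nrad T ^ 2 + t * nrad (T + S) ^ 2 := by
  have hsplit : T + (t : ℂ) • S = ((1 - t : ℝ) : ℂ) • T + (t : ℂ) • (T + S) := by
    push_cast
    module
  have hle : nrad (T + (t : ℂ) • S) ≤ (1 - t) * nrad T + t * nrad (T + S) := by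
    rw [hsplit]
    refine (nrad_add_le _ _).trans_eq ?_
    rw [nrad_smul, nrad_smul, Complex.norm_of_nonneg (sub_nonneg.2 ht1),
      Complex.norm_of_nonneg ht0]
  have hsq := pow_le_pow_left₀ (nrad_nonneg _) hle 2
  nlinarith [mul_nonneg (mul_nonneg ht0 (sub_nonneg.2 ht1)) (sq_nonneg (nrad T - nrad (T + S)))]

omit [CompleteSpace H] in
/-- The difference quotients of `r ↦ nrad (T + (r * u) • S) ^ 2` at `0` are monotone. -/
lemma nrad_sq_slope_mono (T S : H →L[ℂ] H) (u : ℂ) {s r : ℝ} (hs : 0 < s) (hsr : s ≤ r) :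
    (nrad (T + ((s : ℂ) * u) • S) ^ 2 - nrad T ^ 2) / (2 * s) ≤
      (nrad (T + ((r : ℂ) * u) • S) ^ 2 - nrad T ^ 2) / (2 * r) := by
  have hr : 0 < r := hs.trans_le hsr
  have hconv := nrad_add_smul_sq_le T (((r : ℂ) * u) • S) (div_nonneg hs.le hr.le)
    ((div_le_one hr).2 hsr)
  have hrescale : ((s / r : ℝ) : ℂ) • (((r : ℂ) * u) • S) = ((s : ℂ) * u) • S := by
    have : (r : ℂ) ≠ 0 := by exact_mod_cast hr.ne'
    rw [smul_smul]
    congr 1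
    push_cast
    field_simp
  rw [hrescale] at hconv
  rw [div_le_iff₀ (by positivity)]
  calc nrad (T + ((s : ℂ) * u) • S) ^ 2 - nrad T ^ 2
      ≤ s / r * (nrad (T + ((r : ℂ) * u) • S) ^ 2 - nrad T ^ 2) := by linarith
    _ = (nrad (T + ((r : ℂ) * u) • S) ^ 2 - nrad T ^ 2) / (2 * r) * (2 * s) := by
      field_simp

lemma exists_mem_Ico_norm_mul_exp (z : ℂ) :
    ∃ θ ∈ Set.Ico (0 : ℝ) (2 * Real.pi),
      (‖z‖ : ℂ) * Complex.exp ((θ : ℂ) * Complex.I) = z := by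
  have hpi := Real.pi_pos
  rcases le_or_gt 0 z.arg with h | h
  · exact ⟨z.arg, ⟨h, by linarith [z.arg_le_pi]⟩, z.norm_mul_exp_arg_mul_I⟩
  · refine ⟨z.arg + 2 * Real.pi, ⟨by linarith [z.neg_pi_lt_arg], by linarith⟩, ?_⟩
    push_cast
    rw [add_mul, Complex.exp_add, Complex.exp_two_pi_mul_I, mul_one]
    exact z.norm_mul_exp_arg_mul_I

/-- `T ⊥ε_ω S` iff `D^θ_ω(T, S) ≥ −ε ω(T) ω(S)` for every `θ ∈ [0, 2π)`. -/
theorem nradOrth_iff_deriv (ε : ℝ) (hε0 : 0 ≤ ε) (hε1 : ε < 1) (T S : H →L[ℂ] H)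
    (D : ℝ → ℝ)
    (hD : ∀ θ ∈ Set.Ico (0 : ℝ) (2 * Real.pi),
      Tendsto
        (fun r : ℝ =>
          (nrad (T + ((r : ℂ) * Complex.exp ((θ : ℂ) * Complex.I)) • S) ^ 2 - nrad T ^ 2) /
            (2 * r))
        (𝓝[>] (0 : ℝ)) (𝓝 (D θ))) :
    NradOrth ε T S ↔
      ∀ θ ∈ Set.Ico (0 : ℝ) (2 * Real.pi), -ε * nrad T * nrad S ≤ D θ := by
  constructor
  · intro h θ hθ
    refine ge_of_tendsto (hD θ hθ) ?_
    filter_upwards [self_mem_nhdsWithin] with r hr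
    have hr : 0 < r := hr
    have hμ := h ((r : ℂ) * Complex.exp ((θ : ℂ) * Complex.I))
    rw [nrad_smul, norm_mul, Complex.norm_exp_ofReal_mul_I, mul_one,
      Complex.norm_of_nonneg hr.le] at hμ
    rw [le_div_iff₀ (by positivity)]
    linarith
  · intro h μ
    obtain ⟨θ, hθ, hμθ⟩ := exists_mem_Ico_norm_mul_exp μ
    rcases eq_or_ne μ 0 with rfl | hμ0
    · rw [nrad_smul]
      simp
    have hpos : 0 < ‖μ‖ := norm_pos_iff.2 hμ0
    have hle : D θ ≤ (nrad (T + μ • S) ^ 2 - nrad T ^ 2) / (2 * ‖μ‖) := by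
      refine le_of_tendsto (hD θ hθ) ?_
      filter_upwards [Ioc_mem_nhdsGT hpos] with s hs
      simpa only [hμθ] using
        nrad_sq_slope_mono T S (Complex.exp ((θ : ℂ) * Complex.I)) hs.1 hs.2
    have hbound := (h θ hθ).trans hle
    rw [le_div_iff₀ (by positivity)] at hbound
    rw [nrad_smul]
    linarith
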